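/- Let k be a field of characteristic 0 and A a commutative Hopf algebra over k whose comultiplication is cocommutative, such that A is reduced, the prime spectrum of A is connected, and for every positive integer n the ideal of A generated by the image under [n] of the augmentation ideal ker(counit) equals ker(counit) (i.e. the affine group scheme G = Spec A is torsion free: the kernel of multiplication by n on G is trivial). Then for every positive integer n the n-th convolution power [n] : A → A of the identity map is bijective (i.e. multiplication by n is an automorphism of G). -/

import Mathlib

open TensorProduct

/-- The `n`-th convolution power `[n] : A → A` of the identity map of a Hopf algebra `A`:
`[0] = unit ∘ counit` and `[n+1] = mult ∘ ([n] ⊗ id) ∘ comul`.  For a commutative and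
cocommutative Hopf algebra this is the multiplication-by-`n` map of the corresponding
affine group scheme `Spec A`. -/
noncomputable def convPowId (k A : Type*) [CommSemiring k] [Semiring A] [HopfAlgebra k A] :
    ℕ → (A →ₗ[k] A)
  | 0 => Algebra.linearMap k A ∘ₗ Coalgebra.counit
  | n + 1 => LinearMap.mul' k A ∘ₗ
      TensorProduct.map (convPowId k A n) LinearMap.id ∘ₗ Coalgebra.comul

open Coalgebra (comul counit IsCocomm)
open WithConv

section Slices

variable {k M N : Type*} [Field k] [AddCommGroup M] [Module k M] [AddCommGroup N] [Module k N]

/-- Contraction of the left tensor factor against a linear functional. -/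
noncomputable def TensorProduct.contractL (f : M →ₗ[k] k) : M ⊗[k] N →ₗ[k] N :=
  (TensorProduct.lid k N).toLinearMap ∘ₗ f.rTensor N

@[simp]
lemma TensorProduct.contractL_tmul (f : M →ₗ[k] k) (m : M) (n : N) :
    contractL f (m ⊗ₜ[k] n) = f m • n := by
  simp [contractL]

lemma TensorProduct.contractL_mem (f : M →ₗ[k] k) {I : Submodule k N} {x : M ⊗[k] N}
    (hx : x ∈ LinearMap.range (I.subtype.lTensor M)) : contractL f x ∈ I := by
  obtain ⟨y, rfl⟩ := hx
  induction y with
  | zero => simp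
  | add y z hy hz => simpa using I.add_mem hy hz
  | tmul m i => simpa using I.smul_mem _ i.2

lemma TensorProduct.mem_range_map_of_contractL_mem (U : Submodule k M) (I : Submodule k N)
    {x : M ⊗[k] N} (hU : x ∈ LinearMap.range (U.subtype.rTensor N))
    (hI : ∀ f : M →ₗ[k] k, contractL f x ∈ I) :
    x ∈ LinearMap.range (TensorProduct.map U.subtype I.subtype) := by
  classical
  obtain ⟨z, rfl⟩ := hU
  obtain ⟨P, hP⟩ := U.subtype.exists_leftInverse_of_injective U.ker_subtype
  let e := Module.Basis.ofVectorSpace k U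
  have hz (i) : equivFinsuppOfBasisLeft e z i ∈ I := by
    convert hI (e.coord i ∘ₗ P) using 1
    clear hI
    induction z with
    | zero => simp
    | add y z hy hz => simp_all
    | tmul m n =>
      have : P m = m := LinearMap.congr_fun hP m
      simp [this]
  rw [← (equivFinsuppOfBasisLeft e).symm_apply_apply z, equivFinsuppOfBasisLeft_symm_apply]
  rw [Finsupp.sum, map_sum]
  refine Submodule.sum_mem _ fun i _ ↦ ⟨e i ⊗ₜ ⟨_, hz i⟩, by simp⟩

lemma TensorProduct.mem_range_lTensor_of_contractL_mem (I : Submodule k N)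
    {x : M ⊗[k] N} (hI : ∀ f : M →ₗ[k] k, contractL f x ∈ I) :
    x ∈ LinearMap.range (I.subtype.lTensor M) := by
  obtain ⟨z, rfl⟩ := mem_range_map_of_contractL_mem ⊤ I (x := x) (by
    have : Function.Surjective ((⊤ : Submodule k M).subtype.rTensor N) :=
      LinearMap.rTensor_surjective _ fun x ↦ ⟨⟨x, trivial⟩, rfl⟩
    exact this x) hI
  exact ⟨(⊤ : Submodule k M).subtype.rTensor I z, by
    rw [← LinearMap.comp_apply, LinearMap.lTensor_comp_rTensor]⟩

end Slices

section LocallyFinite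

variable {k A : Type*} [Field k] [AddCommGroup A] [Module k A] [Coalgebra k A]

lemma contractL_comul_contractL_comul (f g : A →ₗ[k] k) (a : A) :
    contractL g (comul (R := k) (contractL f (comul (R := k) a))) =
      contractL (toConv f * toConv g).ofConv (comul (R := k) a) := by
  have h1 : ∀ x : A ⊗[k] A, contractL g (comul (R := k) (contractL f x)) =
      contractL f ((contractL (N := A) g).lTensor A (comul.lTensor A x)) := by
    intro x
    induction x with
    | zero => simp
    | add y z hy hz => simp_all
    | tmul m n => simp
  have h2 : ∀ x : A ⊗[k] A, contractL (toConv f * toConv g).ofConv x =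
      contractL f ((contractL (N := A) g).lTensor A
        (TensorProduct.assoc k A A A (comul.rTensor A x))) := by
    intro x
    induction x with
    | zero => simp
    | add y z hy hz => simp_all
    | tmul m n =>
      simp only [contractL_tmul, LinearMap.rTensor_tmul, LinearMap.convMul_def,
        LinearMap.comp_apply, ofConv_toConv]
      induction comul (R := k) m with
      | zero => simp
      | add y z hy hz => simp_all [add_tmul, add_smul]
      | tmul u v => simp [mul_smul, smul_comm (g v)]
  rw [h1, h2, Coalgebra.coassoc_apply]

/-- Every element of a cocommutative coalgebra over a field lies in a finite-dimensional
subcoalgebra. -/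
lemma exists_finite_subcoalgebra [IsCocomm k A] (a : A) :
    ∃ V : Submodule k A, a ∈ V ∧ V.FG ∧
      ∀ v ∈ V, comul (R := k) v ∈ LinearMap.range (TensorProduct.map V.subtype V.subtype) := by
  let s : (A →ₗ[k] k) →ₗ[k] A :=
    { toFun f := contractL f (comul (R := k) a)
      map_add' f g := by simp [contractL, LinearMap.rTensor_add]
      map_smul' c f := by simp [contractL, LinearMap.rTensor_smul] }
  have hL : ∀ v ∈ LinearMap.range s,
      comul (R := k) v ∈ LinearMap.range ((LinearMap.range s).subtype.lTensor A) := by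
    rintro _ ⟨f, rfl⟩
    refine mem_range_lTensor_of_contractL_mem _ fun g ↦ ?_
    exact ⟨_, (contractL_comul_contractL_comul f g a).symm⟩
  refine ⟨LinearMap.range s, ⟨counit, by simp [s, contractL]⟩, ?_, fun v hv ↦ ?_⟩
  · let r := Coalgebra.Repr.arbitrary k a
    refine Submodule.FG.of_le (Submodule.fg_span (r.index.finite_toSet.image r.right)) ?_
    rintro _ ⟨f, rfl⟩
    change contractL f (comul (R := k) a) ∈ _
    rw [← r.eq, map_sum]
    refine Submodule.sum_mem _ fun i hi ↦ ?_
    rw [contractL_tmul]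
    exact Submodule.smul_mem _ _ (Submodule.subset_span ⟨i, hi, rfl⟩)
  · refine mem_range_map_of_contractL_mem _ _ ?_ fun f ↦ contractL_mem f (hL v hv)
    obtain ⟨z, hz⟩ := hL v hv
    refine ⟨TensorProduct.comm k _ _ z, ?_⟩
    rw [← Coalgebra.comm_comul k v, ← hz]
    exact LinearMap.congr_fun (LinearMap.rTensor_comp_comm ..) z

end LocallyFinite

section ConvPow

variable (k A : Type*) [Field k] [CommRing A] [HopfAlgebra k A] [IsCocomm k A]

/-- The `n`-th convolution power of the identity, as a bialgebra endomorphism. -/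
noncomputable def convPowHom (n : ℕ) : A →ₐc[k] A :=
  (toConv (BialgHom.id k A) ^ n).ofConv

variable {A}

lemma convPowHom_zero_apply (a : A) :
    convPowHom k A 0 a = algebraMap k A (counit (R := k) a) := rfl

lemma convPowHom_succ_apply (n : ℕ) (a : A) :
    convPowHom k A (n + 1) a =
      LinearMap.mul' k A (TensorProduct.map (convPowHom k A n : A →ₗ[k] A) LinearMap.id
        (comul (R := k) a)) := by
  rw [convPowHom, pow_succ]
  rfl

lemma convPowId_apply (n : ℕ) (a : A) : convPowId k A n a = convPowHom k A n a := by
  induction n generalizing a with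
  | zero => rfl
  | succ n ih =>
    have h : convPowId k A n = (convPowHom k A n : A →ₗ[k] A) := LinearMap.ext ih
    rw [convPowHom_succ_apply, ← h]
    rfl

lemma convPowHom_comp {B : Type*} [CommRing B] [HopfAlgebra k B] [IsCocomm k B]
    (f : B →ₐc[k] A) (n : ℕ) (b : B) :
    f (convPowHom k B n b) = convPowHom k A n (f b) := by
  induction n generalizing b with
  | zero => simpa [convPowHom_zero_apply] using AlgHomClass.commutes f _
  | succ n ih =>
    rw [convPowHom_succ_apply, convPowHom_succ_apply, ← CoalgHomClass.map_comp_comul_apply]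
    induction comul (R := k) b with
    | zero => simp
    | add y z hy hz => simp_all
    | tmul u v => simp [ih]

end ConvPow

section Group

variable {k A R : Type*} [Field k] [CommRing A] [HopfAlgebra k A] [CommRing R] [Algebra k R]

lemma conv_mul_comp_antipode (f : A →ₐ[k] R) :
    toConv f * toConv (f.comp (HopfAlgebra.antipodeAlgHom k A)) = 1 := by
  have h : toConv (AlgHom.id k A) * toConv (HopfAlgebra.antipodeAlgHom k A) = 1 := by
    apply ofConv_injective
    ext a
    exact HopfAlgebra.mul_antipode_lTensor_comul_apply a
  have := AlgHom.comp_convMul_distrib f (toConv (AlgHom.id k A))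
    (toConv (HopfAlgebra.antipodeAlgHom k A))
  rw [h] at this
  apply ofConv_injective
  refine this.symm.trans ?_
  ext a
  exact f.commutes _

lemma conv_comp_antipode_mul (f : A →ₐ[k] R) :
    toConv (f.comp (HopfAlgebra.antipodeAlgHom k A)) * toConv f = 1 := by
  have := AlgHom.comp_convMul_distrib f (toConv (HopfAlgebra.antipodeAlgHom k A))
    (toConv (AlgHom.id k A))
  rw [AlgHom.antipode_id_cancel] at this
  apply ofConv_injective
  refine this.symm.trans ?_
  ext a
  exact f.commutes _

lemma toConv_comulAlgHom : toConv (Bialgebra.comulAlgHom k A) =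
    toConv (Algebra.TensorProduct.includeLeft : A →ₐ[k] A ⊗[k] A) *
      toConv Algebra.TensorProduct.includeRight := by
  rw [AlgHom.convMul_def]
  congr 1
  conv_lhs => rw [← AlgHom.id_comp (Bialgebra.comulAlgHom k A)]
  rw [← AlgHom.comp_assoc]
  congr 1
  ext <;> simp

lemma toConv_map_comp_comul {f g : A →ₐ[k] R} :
    toConv ((Algebra.TensorProduct.map f g).comp (Bialgebra.comulAlgHom k A)) =
    toConv ((Algebra.TensorProduct.includeLeft : R →ₐ[k] R ⊗[k] R).comp f) *
      toConv ((Algebra.TensorProduct.includeRight : R →ₐ[k] R ⊗[k] R).comp g) := by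
  rw [AlgHom.convMul_def]
  congr 1
  rw [← AlgHom.comp_assoc]
  congr 1
  ext <;> simp

variable (k) in
lemma antipode_antipode_apply (a : A) :
    HopfAlgebra.antipode k (HopfAlgebra.antipode k a) = a := by
  have h := left_inv_eq_right_inv (conv_mul_comp_antipode (AlgHom.id k A))
    (conv_mul_comp_antipode (HopfAlgebra.antipodeAlgHom k A))
  exact (DFunLike.congr_fun (toConv_injective h) a).symm

variable (k) in
lemma comul_antipode_apply [IsCocomm k A] (a : A) :
    comul (R := k) (HopfAlgebra.antipode k a) =
      TensorProduct.map (HopfAlgebra.antipode k) (HopfAlgebra.antipode k) (comul (R := k) a) := by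
  have h : toConv ((Bialgebra.comulAlgHom k A).comp (HopfAlgebra.antipodeAlgHom k A)) =
      toConv ((Algebra.TensorProduct.map (HopfAlgebra.antipodeAlgHom k A)
        (HopfAlgebra.antipodeAlgHom k A)).comp (Bialgebra.comulAlgHom k A)) := by
    refine left_inv_eq_right_inv (conv_comp_antipode_mul _) ?_
    rw [toConv_comulAlgHom, toConv_map_comp_comul, mul_mul_mul_comm, conv_mul_comp_antipode,
      conv_mul_comp_antipode, one_mul]
  exact DFunLike.congr_fun (toConv_injective h) a

end Group

section AugmentationFiltration

variable {k A : Type*} [Field k] [CommRing A] [HopfAlgebra k A] [IsCocomm k A]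

local notation "𝔪" => RingHom.ker (Bialgebra.counitAlgHom k A)

lemma convPowHom_succ_sub_mem (n : ℕ) (x : A) :
    convPowHom k A (n + 1) x - convPowHom k A n x - x +
      algebraMap k A (counit (R := k) x) ∈ 𝔪 ^ 2 := by
  have key : ∀ t : A ⊗[k] A,
      LinearMap.mul' k A (TensorProduct.map (convPowHom k A n : A →ₗ[k] A) LinearMap.id t) -
        convPowHom k A n (TensorProduct.rid k A (counit.lTensor A t)) -
        TensorProduct.lid k A (counit.rTensor A t) +
        algebraMap k A (counit (TensorProduct.lid k A (counit.rTensor A t))) ∈ 𝔪 ^ 2 := by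
    intro t
    induction t with
    | zero => simp
    | add y z hy hz =>
      convert add_mem hy hz using 1
      simp only [map_add]
      ring
    | tmul u v =>
      have h1 : convPowHom k A n u - algebraMap k A (counit (R := k) u) ∈ 𝔪 := by
        simp [RingHom.mem_ker]
      have h2 : v - algebraMap k A (counit (R := k) v) ∈ 𝔪 := by
        simp [RingHom.mem_ker]
      rw [pow_two]
      convert Ideal.mul_mem_mul h1 h2 using 1
      have hc : convPowHom k A n (algebraMap k A (counit (R := k) v)) =
          algebraMap k A (counit (R := k) v) := AlgHomClass.commutes _ _
      simp [Algebra.smul_def, hc]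
      ring
  simpa [convPowHom_succ_apply] using key (comul (R := k) x)

lemma convPowHom_sub_nsmul_mem (n : ℕ) {x : A} (hx : x ∈ 𝔪) :
    convPowHom k A n x - n * x ∈ 𝔪 ^ 2 := by
  have hx' : counit (R := k) x = 0 := hx
  induction n with
  | zero => simp [convPowHom_zero_apply, hx']
  | succ n ih =>
    convert add_mem ih (convPowHom_succ_sub_mem n x) using 1
    simp only [hx', map_zero, Nat.cast_succ]
    ring

lemma convPowHom_sub_pow_mul_mem (n i : ℕ) {x : A} (hx : x ∈ 𝔪 ^ i) :
    convPowHom k A n x - n ^ i * x ∈ 𝔪 ^ (i + 1) := by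
  induction i generalizing x with
  | zero => simp [RingHom.mem_ker]
  | succ i ih =>
    rw [pow_succ] at hx
    induction hx using Submodule.mul_induction_on' with
    | mem_mul_mem u hu v hv =>
      have h1 := Ideal.mul_mem_mul (ih hu)
        (show convPowHom k A n v ∈ 𝔪 by simpa [RingHom.mem_ker] using hv)
      have h2 := Ideal.mul_mem_left _ ((n : A) ^ i)
        (Ideal.mul_mem_mul hu (convPowHom_sub_nsmul_mem n hv))
      rw [← pow_succ] at h1
      rw [← pow_add] at h2
      convert add_mem h1 h2 using 1
      rw [map_mul]
      ring
    | add u _ v _ hu hv =>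
      convert add_mem hu hv using 1
      rw [map_add]
      ring

lemma ker_convPowHom_le_pow [CharZero k] {n : ℕ} (hn : 0 < n) (i : ℕ) :
    RingHom.ker (convPowHom k A n) ≤ 𝔪 ^ i := by
  intro x hx
  induction i with
  | zero => simp
  | succ i ih =>
    have h := convPowHom_sub_pow_mul_mem n i ih
    rw [(RingHom.mem_ker).1 hx, zero_sub, neg_mem_iff] at h
    have h' := Ideal.mul_mem_left _ (algebraMap k A ((n : k) ^ i)⁻¹) h
    have hn' : (n : k) ^ i ≠ 0 := pow_ne_zero _ (Nat.cast_ne_zero.2 hn.ne')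
    rwa [← mul_assoc, ← map_natCast (algebraMap k A), ← map_pow, ← map_mul, inv_mul_cancel₀ hn',
      map_one, one_mul] at h'

/-- The kernel of a convolution power is killed by an element of counit `1`. -/
lemma exists_counit_eq_one_mul_ker_eq_zero [CharZero k] [IsNoetherianRing A] {n : ℕ}
    (hn : 0 < n) :
    ∃ x : A, counit (R := k) x = 1 ∧ ∀ j ∈ RingHom.ker (convPowHom k A n), x * j = 0 := by
  set J := RingHom.ker (convPowHom k A n)
  obtain ⟨m, hm⟩ := Ideal.exists_pow_inf_eq_pow_smul 𝔪 J
  have hJ (i : ℕ) : (𝔪 ^ i • ⊤ ⊓ J : Ideal A) = J := by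
    rw [smul_eq_mul, Ideal.mul_top]
    exact inf_eq_right.2 (ker_convPowHom_le_pow hn i)
  have h := hm (m + 1) (Nat.le_succ m)
  rw [hJ, hJ, Nat.add_sub_cancel_left, pow_one] at h
  obtain ⟨r, hr, hrJ⟩ := Submodule.exists_mem_and_smul_eq_self_of_fg_of_le_smul 𝔪 J
    (IsNoetherian.noetherian J) h.le
  have hr' : counit (R := k) r = 0 := hr
  refine ⟨1 - r, by simp [hr'], fun j hj ↦ ?_⟩
  rw [sub_mul, one_mul, sub_eq_zero]
  exact (hrJ j hj).symm

end AugmentationFiltration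

section KernelAnnihilator

variable {k A : Type*} [Field k] [CommRing A] [HopfAlgebra k A]

lemma conv_antipode_comp_mul {B : Type*} [CommRing B] [HopfAlgebra k B] (φ : B →ₐc[k] A)
    {R : Type*} [CommRing R] [Algebra k R] (f : A →ₐ[k] R) :
    toConv ((f.comp (HopfAlgebra.antipodeAlgHom k A)).comp (φ : B →ₐ[k] A)) *
      toConv (f.comp (φ : B →ₐ[k] A)) = 1 := by
  have := AlgHom.convMul_comp_bialgHom_distrib
    (toConv (f.comp (HopfAlgebra.antipodeAlgHom k A))) (toConv f) φ
  rw [conv_comp_antipode_mul] at this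
  apply ofConv_injective
  refine this.symm.trans ?_
  ext a
  simp

lemma antipode_bialgHom_apply {B : Type*} [CommRing B] [HopfAlgebra k B] (φ : B →ₐc[k] A) (b : B) :
    HopfAlgebra.antipode k (φ b) = φ (HopfAlgebra.antipode k b) := by
  have h := left_inv_eq_right_inv (conv_antipode_comp_mul φ (AlgHom.id k A))
    (conv_mul_comp_antipode _)
  exact DFunLike.congr_fun (toConv_injective h) b

variable (φ : A →ₐc[k] A)

/-- The coaction `a ↦ ∑ φ(a₁) ⊗ a₂` of the image of `φ`. -/
noncomputable def leftCoaction : A →ₐ[k] A ⊗[k] A :=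
  (Algebra.TensorProduct.map (φ : A →ₐ[k] A) (AlgHom.id k A)).comp (Bialgebra.comulAlgHom k A)

lemma conv_antipode_mul_leftCoaction :
    toConv (((Algebra.TensorProduct.includeLeft : A →ₐ[k] A ⊗[k] A).comp
        (HopfAlgebra.antipodeAlgHom k A)).comp (φ : A →ₐ[k] A)) * toConv (leftCoaction φ) =
      toConv Algebra.TensorProduct.includeRight := by
  rw [leftCoaction, toConv_map_comp_comul, ← mul_assoc, conv_antipode_comp_mul, one_mul]
  rfl

lemma leftCoaction_mul_one_tmul {x j : A} (hx : ∀ j ∈ RingHom.ker φ, x * j = 0)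
    (hj : j ∈ RingHom.ker φ) : leftCoaction φ x * (1 ⊗ₜ j) = 0 := by
  let g : A →ₐ[k] A := (HopfAlgebra.antipodeAlgHom k A).comp (φ : A →ₐ[k] A)
  let T : A ⊗[k] A →ₗ[k] A ⊗[k] A := LinearMap.mul' k (A ⊗[k] A) ∘ₗ
    TensorProduct.map (Algebra.TensorProduct.includeLeft : A →ₐ[k] A ⊗[k] A).toLinearMap
      ((leftCoaction φ).toLinearMap ∘ₗ LinearMap.mulLeft k x)
  have hT : T (g.toLinearMap.rTensor A (comul (R := k) j)) = leftCoaction φ x * (1 ⊗ₜ j) := by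
    have h := DFunLike.congr_fun (ofConv_injective.eq_iff.2 (conv_antipode_mul_leftCoaction φ)) j
    change _ = (1 : A) ⊗ₜ[k] j at h
    rw [← h]
    change _ = _ * ((_ * _ : WithConv (A →ₐ[k] A ⊗[k] A)) j)
    rw [AlgHom.convMul_apply]
    induction comul (R := k) j with
    | zero => simp
    | add y z hy hz => simp_all [mul_add]
    | tmul u v =>
      simp [T, g]
      ring
  have hz : (φ : A →ₗ[k] A).lTensor A (g.toLinearMap.rTensor A (comul (R := k) j)) = 0 := by
    have : (φ : A →ₗ[k] A).lTensor A (g.toLinearMap.rTensor A (comul (R := k) j)) =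
        (HopfAlgebra.antipode k (A := A)).rTensor A
          (TensorProduct.map (φ : A →ₗ[k] A) (φ : A →ₗ[k] A) (comul (R := k) j)) := by
      induction comul (R := k) j with
      | zero => simp
      | add y z hy hz => simp_all
      | tmul u v => simp [g]
    rw [this]
    have h2 := CoalgHomClass.map_comp_comul_apply φ j
    rw [(RingHom.mem_ker).1 hj, map_zero] at h2
    rw [show TensorProduct.map (φ : A →ₗ[k] A) (φ : A →ₗ[k] A) (comul (R := k) j) = 0 from h2,
      map_zero]
  obtain ⟨w, hw⟩ := (Module.Flat.lTensor_exact A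
    (LinearMap.exact_subtype_ker_map (φ : A →ₗ[k] A)) _).1 hz
  rw [← hT, ← hw]
  clear hw hT hz
  induction w with
  | zero => simp
  | add y z hy hz => simp_all
  | tmul u v =>
    have : x * (v : A) = 0 := hx v v.2
    simp [T, this]

/-- If `x` annihilates the kernel of `φ`, then `ε(x)` is the image under `φ` of an element that
annihilates the kernel of `φ`. -/
lemma exists_mul_ker_eq_zero_map_eq {x : A} (hx : ∀ j ∈ RingHom.ker φ, x * j = 0) :
    ∃ y : A, (∀ j ∈ RingHom.ker φ, y * j = 0) ∧ φ y = algebraMap k A (counit (R := k) x) := by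
  let K : Submodule k A := (RingHom.ker φ).annihilator.restrictScalars k
  have hK {y : A} : y ∈ K ↔ ∀ j ∈ RingHom.ker φ, y * j = 0 := Submodule.mem_annihilator
  have hmem : leftCoaction φ x ∈ LinearMap.range
      (TensorProduct.map (LinearMap.range (φ : A →ₗ[k] A)).subtype K.subtype) := by
    refine mem_range_map_of_contractL_mem _ _ ?_ fun f ↦ hK.2 fun j hj ↦ ?_
    · refine ⟨(φ : A →ₗ[k] A).rangeRestrict.rTensor A (comul (R := k) x), ?_⟩
      rw [← LinearMap.comp_apply, ← LinearMap.rTensor_comp]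
      rfl
    · have h : ∀ t : A ⊗[k] A, contractL f t * j = contractL f (t * (1 ⊗ₜ j)) := by
        intro t
        induction t with
        | zero => simp
        | add y z hy hz => simp_all [add_mul]
        | tmul u v => simp
      rw [h, leftCoaction_mul_one_tmul φ hx hj, map_zero]
  let E : A ⊗[k] A →ₗ[k] A := LinearMap.mul' k A ∘ₗ
    TensorProduct.map (HopfAlgebra.antipode k (A := A)) (φ : A →ₗ[k] A)
  have hE : E (leftCoaction φ x) = algebraMap k A (counit (R := k) x) := by
    have h := HopfAlgebra.mul_antipode_rTensor_comul_apply (R := k) (φ x)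
    rw [← CoalgHomClass.map_comp_comul_apply, CoalgHomClass.counit_comp_apply] at h
    rw [← h]
    change E (TensorProduct.map (φ : A →ₗ[k] A) LinearMap.id (comul (R := k) x)) = _
    induction comul (R := k) x with
    | zero => simp
    | add y z hy hz => simp_all
    | tmul u v => simp [E]
  have hmemE : E (leftCoaction φ x) ∈ K.map (φ : A →ₗ[k] A) := by
    obtain ⟨w, hw⟩ := hmem
    rw [← hw]
    clear hw hE
    induction w with
    | zero => simp
    | add y z hy hz => simpa using add_mem hy hz
    | tmul u v =>
      obtain ⟨_, u, rfl⟩ := u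
      refine ⟨HopfAlgebra.antipode k u * v, ?_, ?_⟩
      · exact (RingHom.ker φ).annihilator.mul_mem_left _ v.2
      · simp [E, antipode_bialgHom_apply]
  obtain ⟨y, hy, hyE⟩ := hmemE
  exact ⟨y, hK.1 hy, hyE.trans hE⟩

end KernelAnnihilator

lemma convPowHom_injective_of_isNoetherianRing {k A : Type*} [Field k] [CharZero k] [CommRing A]
    [HopfAlgebra k A] [IsCocomm k A] [IsNoetherianRing A]
    (hA : ∀ e : A, IsIdempotentElem e → e = 0 ∨ e = 1) {n : ℕ} (hn : 0 < n) :
    Function.Injective (convPowHom k A n) := by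
  obtain ⟨x, hx1, hx⟩ := exists_counit_eq_one_mul_ker_eq_zero (k := k) (A := A) hn
  obtain ⟨y, hy, hyx⟩ := exists_mul_ker_eq_zero_map_eq _ hx
  rw [hx1, map_one] at hyx
  have hidem : y * (1 - y) = 0 := hy _ (by simp [RingHom.mem_ker, hyx])
  rw [injective_iff_map_eq_zero]
  intro j hj
  have hyj := hy j hj
  rcases hA y (by rw [IsIdempotentElem]; linear_combination -hidem) with rfl | rfl
  · have := congrArg (counit (R := k)) hyx
    simp at this
  · simpa using hyj

section HopfSubalgebra

section

variable {R M N : Type*} [CommSemiring R] [AddCommMonoid M] [Module R M] [AddCommMonoid N]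
  [Module R N] (i : M →ₗ[R] N) (Δ : M →ₗ[R] M ⊗[R] M) (D : N →ₗ[R] N ⊗[R] N)

lemma TensorProduct.map_map_assoc_rTensor (h : ∀ m, TensorProduct.map i i (Δ m) = D (i m))
    (t : M ⊗[R] M) :
    TensorProduct.map i (TensorProduct.map i i) (TensorProduct.assoc R M M M (Δ.rTensor M t)) =
      TensorProduct.assoc R N N N (D.rTensor N (TensorProduct.map i i t)) := by
  induction t with
  | zero => simp
  | add y z hy hz => simp_all
  | tmul u v =>
    simp only [LinearMap.rTensor_tmul, TensorProduct.map_tmul, ← h u]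
    induction Δ u with
    | zero => simp
    | add y z hy hz => simp_all [add_tmul]
    | tmul u v => simp

lemma TensorProduct.map_map_lTensor (h : ∀ m, TensorProduct.map i i (Δ m) = D (i m))
    (t : M ⊗[R] M) :
    TensorProduct.map i (TensorProduct.map i i) (Δ.lTensor M t) =
      D.lTensor N (TensorProduct.map i i t) := by
  induction t with
  | zero => simp
  | add y z hy hz => simp_all
  | tmul u v => simp [h]

end

variable {k A : Type*} [Field k] [CommRing A] [HopfAlgebra k A]

lemma Subalgebra.map_val_val_injective (B : Subalgebra k A) :
    Function.Injective (Algebra.TensorProduct.map B.val B.val) := by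
  change Function.Injective (TensorProduct.map B.val.toLinearMap B.val.toLinearMap)
  exact TensorProduct.map_injective_of_flat_flat _ _ Subtype.val_injective Subtype.val_injective

/-- Comultiplication of a subalgebra `B` with `Δ(B) ⊆ B ⊗ B`. -/
noncomputable def Subalgebra.comulRestrict (B : Subalgebra k A)
    (hB : ∀ b ∈ B, comul (R := k) b ∈ (Algebra.TensorProduct.map B.val B.val).range) :
    B →ₐ[k] B ⊗[k] B :=
  (AlgEquiv.ofInjective _ B.map_val_val_injective).symm.toAlgHom.comp
    (((Bialgebra.comulAlgHom k A).comp B.val).codRestrict _ fun b ↦ hB b b.2)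

lemma Subalgebra.map_comulRestrict (B : Subalgebra k A)
    (hB : ∀ b ∈ B, comul (R := k) b ∈ (Algebra.TensorProduct.map B.val B.val).range) (b : B) :
    Algebra.TensorProduct.map B.val B.val (B.comulRestrict hB b) = comul (R := k) (b : A) := by
  have := (AlgEquiv.ofInjective _ B.map_val_val_injective).apply_symm_apply
    (((Bialgebra.comulAlgHom k A).comp B.val).codRestrict _ (fun b ↦ hB b b.2) b)
  exact congrArg Subtype.val this

/-- A subalgebra that is stable under comultiplication is a bialgebra. -/
noncomputable abbrev Subalgebra.bialgebra (B : Subalgebra k A)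
    (hB : ∀ b ∈ B, comul (R := k) b ∈ (Algebra.TensorProduct.map B.val B.val).range) :
    Bialgebra k B :=
  Bialgebra.ofAlgHom (B.comulRestrict hB) ((Bialgebra.counitAlgHom k A).comp B.val)
    (by
      ext b
      have hinj : Function.Injective (TensorProduct.map B.val.toLinearMap
          (TensorProduct.map B.val.toLinearMap B.val.toLinearMap)) :=
        TensorProduct.map_injective_of_flat_flat _ _ Subtype.val_injective B.map_val_val_injective
      apply hinj
      have hΔ := B.map_comulRestrict hB
      refine (TensorProduct.map_map_assoc_rTensor B.val.toLinearMap _ comul hΔ _).trans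
        (Eq.trans ?_ (TensorProduct.map_map_lTensor B.val.toLinearMap _ comul hΔ _).symm)
      exact (congrArg (fun t ↦ TensorProduct.assoc k A A A (comul.rTensor A t)) (hΔ b)).trans
        ((Coalgebra.coassoc_apply _).trans (congrArg (comul.lTensor A) (hΔ b)).symm))
    (by
      ext b
      apply (TensorProduct.lid k B).injective
      apply Subtype.val_injective
      have h (t : B ⊗[k] B) : (TensorProduct.lid k B (Algebra.TensorProduct.map
          ((Bialgebra.counitAlgHom k A).comp B.val) (.id k B) t) : A) =
          TensorProduct.lid k A (counit.rTensor A (Algebra.TensorProduct.map B.val B.val t)) := by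
        induction t with
        | zero => simp
        | add y z hy hz => simp_all
        | tmul u v => simp
      refine (h _).trans ?_
      refine (congrArg (fun t ↦ TensorProduct.lid k A (counit.rTensor A t))
        (B.map_comulRestrict hB b)).trans ?_
      simp)
    (by
      ext b
      apply (TensorProduct.rid k B).injective
      apply Subtype.val_injective
      have h (t : B ⊗[k] B) : (TensorProduct.rid k B (Algebra.TensorProduct.map
          (.id k B) ((Bialgebra.counitAlgHom k A).comp B.val) t) : A) =
          TensorProduct.rid k A (counit.lTensor A (Algebra.TensorProduct.map B.val B.val t)) := by
        induction t with
        | zero => simp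
        | add y z hy hz => simp_all
        | tmul u v => simp
      refine (h _).trans ?_
      refine (congrArg (fun t ↦ TensorProduct.rid k A (counit.lTensor A t))
        (B.map_comulRestrict hB b)).trans ?_
      simp)

/-- A subalgebra that is stable under comultiplication and antipode is a Hopf algebra. -/
noncomputable abbrev Subalgebra.hopfAlgebra (B : Subalgebra k A)
    (hB : ∀ b ∈ B, comul (R := k) b ∈ (Algebra.TensorProduct.map B.val B.val).range)
    (hS : ∀ b ∈ B, HopfAlgebra.antipode k b ∈ B) : HopfAlgebra k B :=
  letI := B.bialgebra hB
  HopfAlgebra.ofAlgHom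
    (((HopfAlgebra.antipodeAlgHom k A).comp B.val).codRestrict B fun b ↦ hS b b.2)
    (by
      ext b
      have h (t : B ⊗[k] B) : (Algebra.TensorProduct.lift
          (((HopfAlgebra.antipodeAlgHom k A).comp B.val).codRestrict B fun b ↦ hS b b.2)
          (.id k B) (fun _ ↦ Commute.all _) t : A) =
          LinearMap.mul' k A ((HopfAlgebra.antipode k).rTensor A
            (Algebra.TensorProduct.map B.val B.val t)) := by
        induction t with
        | zero => simp
        | add y z hy hz => simp_all
        | tmul u v =>
          exact congrArg Subtype.val (Algebra.TensorProduct.lift_tmul _ _ _ u v)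
      refine (h _).trans ?_
      erw [B.map_comulRestrict hB]
      exact HopfAlgebra.mul_antipode_rTensor_comul_apply _)
    (by
      ext b
      have h (t : B ⊗[k] B) : (Algebra.TensorProduct.lift (.id k B)
          (((HopfAlgebra.antipodeAlgHom k A).comp B.val).codRestrict B fun b ↦ hS b b.2)
          (fun _ _ ↦ Commute.all _ _) t : A) =
          LinearMap.mul' k A ((HopfAlgebra.antipode k).lTensor A
            (Algebra.TensorProduct.map B.val B.val t)) := by
        induction t with
        | zero => simp
        | add y z hy hz => simp_all
        | tmul u v =>
          exact congrArg Subtype.val (Algebra.TensorProduct.lift_tmul _ _ _ u v)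
      refine (h _).trans ?_
      erw [B.map_comulRestrict hB]
      exact HopfAlgebra.mul_antipode_lTensor_comul_apply _)

lemma Subalgebra.isCocomm [IsCocomm k A] (B : Subalgebra k A)
    (hB : ∀ b ∈ B, comul (R := k) b ∈ (Algebra.TensorProduct.map B.val B.val).range)
    (hS : ∀ b ∈ B, HopfAlgebra.antipode k b ∈ B) :
    letI := B.hopfAlgebra hB hS
    IsCocomm k B := by
  let := B.hopfAlgebra hB hS
  refine ⟨LinearMap.ext fun b ↦ B.map_val_val_injective ?_⟩
  have h (t : B ⊗[k] B) : Algebra.TensorProduct.map B.val B.val (TensorProduct.comm k B B t) =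
      TensorProduct.comm k A A (Algebra.TensorProduct.map B.val B.val t) := by
    induction t with
    | zero => simp
    | add y z hy hz => simp_all
    | tmul u v => simp
  refine (h _).trans ?_
  change TensorProduct.comm k A A (Algebra.TensorProduct.map B.val B.val (B.comulRestrict hB b)) =
    Algebra.TensorProduct.map B.val B.val (B.comulRestrict hB b)
  rw [B.map_comulRestrict hB, Coalgebra.comm_comul]

/-- The inclusion of a Hopf subalgebra. -/
noncomputable abbrev Subalgebra.hopfVal (B : Subalgebra k A)
    (hB : ∀ b ∈ B, comul (R := k) b ∈ (Algebra.TensorProduct.map B.val B.val).range)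
    (hS : ∀ b ∈ B, HopfAlgebra.antipode k b ∈ B) :
    letI := B.hopfAlgebra hB hS
    B →ₐc[k] A :=
  letI := B.hopfAlgebra hB hS
  BialgHom.ofAlgHom B.val rfl (AlgHom.ext (B.map_comulRestrict hB))

/-- Every element of a commutative and cocommutative Hopf algebra over a field lies in a finitely
generated Hopf subalgebra. -/
lemma exists_fg_hopfSubalgebra [IsCocomm k A] (a : A) :
    ∃ B : Subalgebra k A, a ∈ B ∧ B.FG ∧
      (∀ b ∈ B, comul (R := k) b ∈ (Algebra.TensorProduct.map B.val B.val).range) ∧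
      ∀ b ∈ B, HopfAlgebra.antipode k b ∈ B := by
  obtain ⟨V, ha, hV, hcomul⟩ := exists_finite_subcoalgebra (k := k) a
  let S : A →ₐ[k] A := HopfAlgebra.antipodeAlgHom k A
  let W : Submodule k A := V ⊔ V.map S.toLinearMap
  have hW : W.FG := hV.sup (hV.map _)
  obtain ⟨s, hs⟩ := hW
  let B := Algebra.adjoin k (W : Set A)
  have hVB : ∀ v ∈ V, v ∈ B := fun v hv ↦ Algebra.subset_adjoin (Submodule.mem_sup_left hv)
  have hSB : ∀ v ∈ V, S v ∈ B := fun v hv ↦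
    Algebra.subset_adjoin (Submodule.mem_sup_right ⟨v, hv, rfl⟩)
  have hle {C : Subalgebra k A} (h1 : ∀ v ∈ V, v ∈ C) (h2 : ∀ v ∈ V, S v ∈ C) : B ≤ C := by
    refine Algebra.adjoin_le ?_
    change W ≤ Subalgebra.toSubmodule C
    refine sup_le h1 ?_
    rintro _ ⟨v, hv, rfl⟩
    exact h2 v hv
  refine ⟨B, hVB a ha, ⟨s, ?_⟩, ?_, ?_⟩
  · rw [← Algebra.adjoin_span, hs]
  · refine hle (C := (Algebra.TensorProduct.map B.val B.val).range.comap
      (Bialgebra.comulAlgHom k A)) (fun v hv ↦ ?_) fun v hv ↦ ?_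
    · obtain ⟨w, hw⟩ := hcomul v hv
      change comul (R := k) v ∈ (Algebra.TensorProduct.map B.val B.val).range
      rw [← hw]
      clear hw
      induction w with
      | zero => simp
      | add y z hy hz => rw [map_add]; exact add_mem hy hz
      | tmul u v => exact ⟨⟨u, hVB u u.2⟩ ⊗ₜ ⟨v, hVB v v.2⟩, by simp⟩
    · obtain ⟨w, hw⟩ := hcomul v hv
      change comul (R := k) (HopfAlgebra.antipode k v) ∈
        (Algebra.TensorProduct.map B.val B.val).range
      rw [comul_antipode_apply, ← hw]
      clear hw
      induction w with
      | zero => simp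
      | add y z hy hz => rw [map_add, map_add]; exact add_mem hy hz
      | tmul u v => exact ⟨⟨S u, hSB u u.2⟩ ⊗ₜ ⟨S v, hSB v v.2⟩, by simp [S]⟩
  · refine hle (C := B.comap S) hSB fun v hv ↦ ?_
    change HopfAlgebra.antipode k (HopfAlgebra.antipode k v) ∈ B
    rw [antipode_antipode_apply]
    exact hVB v hv

end HopfSubalgebra

lemma eq_zero_or_one_of_isIdempotentElem_of_connectedSpace {A : Type*} [CommRing A]
    [ConnectedSpace (PrimeSpectrum A)] (e : A) (he : IsIdempotentElem e) : e = 0 ∨ e = 1 := by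
  let E := PrimeSpectrum.isIdempotentElemEquivClopens (R := A)
  rcases isClopen_iff.1 (E ⟨e, he⟩).isClopen with h | h
  · have h' : E ⟨e, he⟩ = ⊥ := TopologicalSpace.Clopens.ext h
    rw [← E.eq_symm_apply, PrimeSpectrum.isIdempotentElemEquivClopens_symm_bot] at h'
    exact .inl (congrArg Subtype.val h')
  · have h' : E ⟨e, he⟩ = ⊤ := TopologicalSpace.Clopens.ext h
    rw [← E.eq_symm_apply, PrimeSpectrum.isIdempotentElemEquivClopens_symm_top] at h'
    exact .inr (congrArg Subtype.val h')

lemma convPowHom_injective {k A : Type*} [Field k] [CharZero k] [CommRing A]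
    [HopfAlgebra k A] [IsCocomm k A]
    (hA : ∀ e : A, IsIdempotentElem e → e = 0 ∨ e = 1) {n : ℕ} (hn : 0 < n) :
    Function.Injective (convPowHom k A n) := by
  rw [injective_iff_map_eq_zero]
  intro a ha
  obtain ⟨B, haB, hfg, hB, hS⟩ := exists_fg_hopfSubalgebra (k := k) a
  let := B.hopfAlgebra hB hS
  have := B.isCocomm hB hS
  have : Algebra.FiniteType k B := B.fg_iff_finiteType.1 hfg
  have : IsNoetherianRing B := Algebra.FiniteType.isNoetherianRing k B
  have hidem (e : B) (he : IsIdempotentElem e) : e = 0 ∨ e = 1 := by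
    rcases hA e (congrArg Subtype.val he) with h | h
    · exact .inl (Subtype.ext h)
    · exact .inr (Subtype.ext h)
  have h := convPowHom_comp k (B.hopfVal hB hS) n ⟨a, haB⟩
  have h0 : convPowHom k B n ⟨a, haB⟩ = 0 := Subtype.ext (h.trans ha)
  exact congrArg Subtype.val
    (convPowHom_injective_of_isNoetherianRing hidem hn (h0.trans (map_zero _).symm))

section Epi

lemma Algebra.IsEpi.exists_smul_eq_algebraMap {C : Type*} (K : Type*) {A : Type*} [CommRing C]
    [Field K] [Algebra C K] [CommRing A] [Algebra C A] [Algebra.IsEpi C A] [FaithfulSMul C A]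
    (M : Submonoid C) [IsLocalization M K] (hM : 0 ∉ M) (a : A) :
    ∃ s ∈ M, ∃ c, s • a = algebraMap C A c := by
  let ι : A →ₗ[C] K ⊗[C] A := TensorProduct.mk C K A 1
  have hι : IsLocalizedModule M ι :=
    (isLocalizedModule_iff_isBaseChange M K ι).2 (TensorProduct.isBaseChange C A K)
  have h1 : ι 1 ≠ 0 := by
    intro h
    obtain ⟨s, hs⟩ := (IsLocalizedModule.eq_zero_iff M ι).1 h
    refine hM ?_
    rw [Submonoid.smul_def, ← Algebra.algebraMap_eq_smul_one,
      FaithfulSMul.algebraMap_eq_zero_iff] at hs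
    exact hs ▸ s.2
  obtain ⟨f, hf⟩ := Module.exists_dual_forall_apply_eq_one (K := K) (s := ({()} : Set Unit))
    (v := fun _ ↦ ι 1) (by simpa using h1)
  have hf : f (ι 1) = 1 := hf () rfl
  let b : A →ₗ[C] A →ₗ[C] K ⊗[C] A :=
    LinearMap.mk₂ C (fun x y ↦ f (ι x) • ι y) (by simp [add_smul])
      (fun c x y ↦ by
        rw [map_smul, ← IsScalarTower.algebraMap_smul K c (ι x), map_smul, smul_eq_mul, mul_smul,
          IsScalarTower.algebraMap_smul])
      (by simp) (fun c x y ↦ by rw [map_smul, smul_comm])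
  have hb := congrArg (_root_.TensorProduct.lift b) (Algebra.tmul_comm C (1 : A) a)
  simp only [_root_.TensorProduct.lift.tmul, b, LinearMap.mk₂_apply, hf, one_smul] at hb
  obtain ⟨⟨c, s⟩, hcs⟩ := IsLocalization.surj M (f (ι a))
  dsimp at hcs
  have h : ι ((s : C) • a) = ι (algebraMap C A c) := by
    rw [map_smul, hb, ← IsScalarTower.algebraMap_smul K (s : C), smul_smul, mul_comm, hcs,
      IsScalarTower.algebraMap_smul, ← map_smul, Algebra.algebraMap_eq_smul_one]
  obtain ⟨t, ht⟩ := (IsLocalizedModule.eq_iff_exists M ι).1 h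
  refine ⟨t * s, mul_mem t.2 s.2, t * c, ?_⟩
  rw [mul_smul, map_mul, ← Algebra.smul_def]
  exact ht

/-- If `A` is an epimorphic extension of a reduced ring `C`, then finitely many elements of `A`
have a common nonzero denominator in `C`. -/
lemma Algebra.IsEpi.exists_ne_zero_smul_eq_algebraMap {C A : Type*} [CommRing C] [IsReduced C]
    [Nontrivial C] [CommRing A] [Algebra C A] [Algebra.IsEpi C A] [FaithfulSMul C A]
    (S : Finset A) : ∃ s : C, s ≠ 0 ∧ ∀ a ∈ S, ∃ c, s • a = algebraMap C A c := by
  obtain ⟨p, hp⟩ := Ideal.nonempty_minimalPrimes (bot_ne_top (α := Ideal C))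
  have : p.IsPrime := hp.1.1
  have := Ring.KrullDimLE.of_isLocalization p hp (Localization.AtPrime p)
  have hK := Ring.KrullDimLE.isField_of_isReduced (R := Localization.AtPrime p)
  let := hK.toField
  have h (a : A) := Algebra.IsEpi.exists_smul_eq_algebraMap (Localization.AtPrime p)
    p.primeCompl (fun h ↦ h p.zero_mem) a
  choose s hs c hc using h
  refine ⟨∏ a ∈ S, s a, fun h0 ↦ ?_, fun a ha ↦ ?_⟩
  · have := prod_mem (S := p.primeCompl) (t := S) fun a _ ↦ hs a
    exact this (h0 ▸ p.zero_mem)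
  · classical
    refine ⟨(∏ x ∈ S.erase a, s x) * c a, ?_⟩
    rw [← Finset.prod_erase_mul _ _ ha, mul_smul, hc, map_mul, Algebra.smul_def]

variable {k A : Type*} [Field k] [CommRing A] [HopfAlgebra k A] {B : Type*} [CommRing B]
  [HopfAlgebra k B] (φ : B →ₐc[k] A)

lemma BialgHom.algHom_ext_of_span_image_ker_counit
    (hφ : Ideal.span (φ '' (RingHom.ker (Bialgebra.counitAlgHom k B) : Set B)) =
      RingHom.ker (Bialgebra.counitAlgHom k A))
    {R : Type*} [CommRing R] [Algebra k R] {f g : A →ₐ[k] R}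
    (h : f.comp (φ : B →ₐ[k] A) = g.comp (φ : B →ₐ[k] A)) : f = g := by
  let d := toConv (f.comp (HopfAlgebra.antipodeAlgHom k A)) * toConv g
  have hd1 : d.ofConv.comp (φ : B →ₐ[k] A) =
      (Algebra.ofId k R).comp (Bialgebra.counitAlgHom k B) := by
    have h2 := AlgHom.convMul_comp_bialgHom_distrib
      (toConv (f.comp (HopfAlgebra.antipodeAlgHom k A))) (toConv g) φ
    have h3 := conv_antipode_comp_mul φ f
    rw [h] at h3
    exact h2.trans (congrArg WithConv.ofConv h3)
  have hker : RingHom.ker (Bialgebra.counitAlgHom k A) ≤ RingHom.ker d.ofConv := by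
    rw [← hφ, Ideal.span_le]
    rintro _ ⟨b, hb, rfl⟩
    refine (DFunLike.congr_fun hd1 b).trans ?_
    have hb : counit (R := k) b = 0 := hb
    simp [hb]
  have hd : d = 1 := by
    apply ofConv_injective
    ext a
    have ha : a - algebraMap k A (counit (R := k) a) ∈
        RingHom.ker (Bialgebra.counitAlgHom k A) := by
      simp [RingHom.mem_ker]
    have := hker ha
    rw [RingHom.mem_ker, map_sub, sub_eq_zero, AlgHom.commutes] at this
    exact this
  have := congrArg (toConv f * ·) hd
  simp only [d, ← mul_assoc, conv_mul_comp_antipode, one_mul, mul_one] at this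
  exact (toConv_injective this).symm

lemma BialgHom.isEpi_range
    (hφ : Ideal.span (φ '' (RingHom.ker (Bialgebra.counitAlgHom k B) : Set B)) =
      RingHom.ker (Bialgebra.counitAlgHom k A)) :
    Algebra.IsEpi (φ : B →ₐ[k] A).range A := by
  rw [Algebra.isEpi_iff_forall_one_tmul_eq]
  let C := (φ : B →ₐ[k] A).range
  have h := φ.algHom_ext_of_span_image_ker_counit hφ
    (f := (Algebra.TensorProduct.includeLeft : A →ₐ[C] A ⊗[C] A).restrictScalars k)
    (g := (Algebra.TensorProduct.includeRight : A →ₐ[C] A ⊗[C] A).restrictScalars k) (by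
      ext b
      let c : C := ⟨φ b, b, rfl⟩
      change (algebraMap C A c) ⊗ₜ[C] (1 : A) = (1 : A) ⊗ₜ[C] (algebraMap C A c)
      rw [Algebra.algebraMap_eq_smul_one, TensorProduct.smul_tmul])
  exact fun a ↦ (DFunLike.congr_fun h a).symm

end Epi

section Conductor

variable {k A : Type*} [Field k] [CommRing A] [HopfAlgebra k A]

lemma conv_comulAlgHom_mul_antipode [IsCocomm k A] :
    toConv (Bialgebra.comulAlgHom k A) *
      toConv ((Algebra.TensorProduct.includeLeft : A →ₐ[k] A ⊗[k] A).comp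
        (HopfAlgebra.antipodeAlgHom k A)) = toConv Algebra.TensorProduct.includeRight := by
  rw [toConv_comulAlgHom, mul_right_comm, conv_mul_comp_antipode, one_mul]

lemma comul_mul_one_tmul_mem [IsCocomm k A] (C : Subalgebra k A)
    (hC : ∀ c ∈ C, comul (R := k) c ∈ (Algebra.TensorProduct.map (.id k A) C.val).range)
    {V : Submodule k A}
    (hV : ∀ v ∈ V, comul (R := k) v ∈ LinearMap.range (TensorProduct.map V.subtype V.subtype))
    {b : A} (hb : ∀ v ∈ V, b * v ∈ C) {v : A} (hv : v ∈ V) :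
    comul (R := k) b * (1 ⊗ₜ v) ∈ (Algebra.TensorProduct.map (.id k A) C.val).range := by
  let T : A ⊗[k] A →ₗ[k] A ⊗[k] A := LinearMap.mul' k (A ⊗[k] A) ∘ₗ
    TensorProduct.map comul ((Algebra.TensorProduct.includeLeft : A →ₐ[k] A ⊗[k] A).comp
      (HopfAlgebra.antipodeAlgHom k A)).toLinearMap
  have hT : T (comul (R := k) v) = 1 ⊗ₜ v := by
    have h := DFunLike.congr_fun (ofConv_injective.eq_iff.2 (conv_comulAlgHom_mul_antipode
      (k := k) (A := A))) v
    change _ = (1 : A) ⊗ₜ[k] v at h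
    rw [← h]
    change _ = (_ * _ : WithConv (A →ₐ[k] A ⊗[k] A)) v
    rw [AlgHom.convMul_apply]
    induction comul (R := k) v with
    | zero => simp
    | add y z hy hz => simp_all
    | tmul u v => simp [T]
  rw [← hT]
  obtain ⟨w, hw⟩ := hV v hv
  rw [← hw]
  clear hw
  induction w with
  | zero => simp
  | add y z hy hz => rw [map_add, map_add, mul_add]; exact add_mem hy hz
  | tmul u c =>
    have h : comul (R := k) b * T (TensorProduct.map V.subtype V.subtype (u ⊗ₜ c)) =
        comul (R := k) (b * (u : A)) * (HopfAlgebra.antipode k (c : A) ⊗ₜ 1) := by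
      simp [T, mul_assoc]
    rw [h]
    exact mul_mem (hC _ (hb u u.2)) ⟨HopfAlgebra.antipode k (c : A) ⊗ₜ 1, by simp⟩

lemma contractL_mul_one_tmul (f : A →ₗ[k] k) (t : A ⊗[k] A) (a : A) :
    contractL f (t * (1 ⊗ₜ a)) = contractL f t * a := by
  induction t with
  | zero => simp
  | add y z hy hz => simp_all [add_mul]
  | tmul u v => simp

/-- If a Hopf subalgebra contains a nonzero multiple of a subcoalgebra, then it contains the
subcoalgebra. -/
lemma le_of_exists_ne_zero_mul_mem [IsCocomm k A] (C : Subalgebra k A)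
    (hC : ∀ c ∈ C, comul (R := k) c ∈ (Algebra.TensorProduct.map C.val C.val).range)
    (hS : ∀ c ∈ C, HopfAlgebra.antipode k c ∈ C) {V : Submodule k A}
    (hV : ∀ v ∈ V, comul (R := k) v ∈ LinearMap.range (TensorProduct.map V.subtype V.subtype))
    {b : A} (hbC : b ∈ C) (hb0 : b ≠ 0) (hb : ∀ v ∈ V, b * v ∈ C) {v : A} (hv : v ∈ V) :
    v ∈ C := by
  let C' := Subalgebra.toSubmodule C
  have hC' {c : A} (hc : c ∈ C) : comul (R := k) c ∈
      LinearMap.range (TensorProduct.map C'.subtype C'.subtype) := hC c hc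
  have hCl {c : A} (hc : c ∈ C) :
      comul (R := k) c ∈ (Algebra.TensorProduct.map (.id k A) C.val).range := by
    obtain ⟨z, hz⟩ := hC' hc
    refine ⟨C'.subtype.rTensor C z, ?_⟩
    rw [← hz]
    exact LinearMap.congr_fun (LinearMap.lTensor_comp_rTensor (f := C'.subtype) (g := C'.subtype)) z
  have hCr {c : A} (hc : c ∈ C) : comul (R := k) c ∈ LinearMap.range (C'.subtype.rTensor A) := by
    obtain ⟨z, hz⟩ := hC' hc
    refine ⟨C'.subtype.lTensor C z, ?_⟩
    rw [← hz]
    exact LinearMap.congr_fun (LinearMap.rTensor_comp_lTensor (f := C'.subtype) (g := C'.subtype)) z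
  let I : Submodule k A :=
    { carrier := {y | y ∈ C ∧ ∀ v ∈ V, y * v ∈ C}
      zero_mem' := by simp
      add_mem' hx hy := ⟨add_mem hx.1 hy.1, fun v hv ↦ by
        rw [add_mul]; exact add_mem (hx.2 v hv) (hy.2 v hv)⟩
      smul_mem' c x hx := ⟨C.smul_mem hx.1 c, fun v hv ↦ by
        rw [smul_mul_assoc]; exact C.smul_mem (hx.2 v hv) c⟩ }
  have hI {y : A} (hy : y ∈ I) : comul (R := k) y ∈
      LinearMap.range (TensorProduct.map C'.subtype I.subtype) := by
    refine mem_range_map_of_contractL_mem _ _ (hCr hy.1) fun f ↦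
      ⟨contractL_mem (I := C') f (hCl hy.1), fun v hv ↦ ?_⟩
    rw [← contractL_mul_one_tmul]
    exact contractL_mem (I := C') f (comul_mul_one_tmul_mem C (fun c hc ↦ hCl hc) hV hy.2 hv)
  obtain ⟨y, hy, hy0⟩ : ∃ y ∈ I, counit (R := k) y ≠ 0 := by
    by_contra! h
    obtain ⟨w, hw⟩ := hI (y := b) ⟨hbC, hb⟩
    have h1 : TensorProduct.rid k A (counit.lTensor A (comul (R := k) b)) = b := by simp
    rw [← hw] at h1
    refine hb0 (h1.symm.trans ?_)
    clear hw h1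
    induction w with
    | zero => simp
    | add y z hy hz => simp_all
    | tmul u v => simp [h v v.2]
  have h1 : algebraMap k A (counit (R := k) y) ∈ I := by
    rw [← HopfAlgebra.mul_antipode_rTensor_comul_apply]
    obtain ⟨w, hw⟩ := hI hy
    rw [← hw]
    clear hw
    induction w with
    | zero => simp
    | add y z hy hz => simp only [map_add]; exact add_mem hy hz
    | tmul u v =>
      have h (v : I) : HopfAlgebra.antipode k (u : A) * v ∈ I :=
        ⟨mul_mem (hS u u.2) v.2.1, fun x hx ↦ by
          rw [mul_assoc]; exact mul_mem (hS u u.2) (v.2.2 x hx)⟩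
      simpa using h v
  have h2 : (1 : A) ∈ I := by
    have := I.smul_mem (counit (R := k) y)⁻¹ h1
    rwa [Algebra.algebraMap_eq_smul_one, smul_smul, inv_mul_cancel₀ hy0, one_smul] at this
  simpa using h2.2 v hv

/-- A homomorphism of commutative Hopf algebras with reduced cocommutative target is surjective
if the image of the augmentation ideal generates the augmentation ideal. -/
lemma BialgHom.surjective_of_span_image_ker_counit [IsCocomm k A] [IsReduced A]
    {B : Type*} [CommRing B] [HopfAlgebra k B] (φ : B →ₐc[k] A)
    (hφ : Ideal.span (φ '' (RingHom.ker (Bialgebra.counitAlgHom k B) : Set B)) =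
      RingHom.ker (Bialgebra.counitAlgHom k A)) : Function.Surjective φ := by
  intro a
  have : Nontrivial A := (Bialgebra.counitAlgHom k A).toRingHom.domain_nontrivial
  let C := (φ : B →ₐ[k] A).range
  have : Algebra.IsEpi C A := φ.isEpi_range hφ
  have : IsReduced C := isReduced_of_injective C.val Subtype.val_injective
  obtain ⟨V, ha, ⟨s, hs⟩, hV⟩ := exists_finite_subcoalgebra (k := k) a
  obtain ⟨b, hb0, hb⟩ := Algebra.IsEpi.exists_ne_zero_smul_eq_algebraMap (C := C) s
  refine le_of_exists_ne_zero_mul_mem C ?_ ?_ hV b.2 (by simpa using hb0) ?_ ha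
  · rintro _ ⟨x, rfl⟩
    have h := CoalgHomClass.map_comp_comul_apply φ x
    change comul (R := k) (φ x) ∈ _
    rw [← h]
    induction comul (R := k) x with
    | zero => simp
    | add y z hy hz => rw [map_add]; exact add_mem hy hz
    | tmul u v => exact ⟨⟨φ u, u, rfl⟩ ⊗ₜ ⟨φ v, v, rfl⟩, by simp⟩
  · rintro _ ⟨x, rfl⟩
    exact ⟨HopfAlgebra.antipode k x, (antipode_bialgHom_apply φ x).symm⟩
  · have hle : V ≤ (Subalgebra.toSubmodule C).comap (LinearMap.mulLeft k (b : A)) := by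
      rw [← hs, Submodule.span_le]
      intro x hx
      obtain ⟨c, hc⟩ := hb x hx
      change (b : A) * x ∈ C
      have : (b : A) * x = c := hc
      exact this ▸ c.2
    exact fun v hv ↦ hle hv

end Conductor

/-- Let `k` be a field of characteristic `0` and `A` a commutative, cocommutative Hopf
algebra over `k` which is reduced and has connected prime spectrum.  Assume moreover that
for every `n > 0` the ideal generated by the image under `[n]` of the augmentation ideal
`ker(counit)` equals the augmentation ideal (i.e. `Spec A` is a torsion free group scheme).
Then for every `n > 0` the convolution power `[n] : A → A` is bijective, i.e. multiplication
by `n` is an automorphism of the group scheme `Spec A`. -/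
theorem convPowId_bijective_of_torsionFree (k A : Type*) [Field k] [CharZero k] [CommRing A]
    [HopfAlgebra k A]
    (hcocomm : (TensorProduct.comm k A A).toLinearMap ∘ₗ
        (Coalgebra.comul (R := k) (A := A)) = Coalgebra.comul)
    (hred : IsReduced A) (hconn : ConnectedSpace (PrimeSpectrum A))
    (htf : ∀ n : ℕ, 0 < n →
      Ideal.span (convPowId k A n '' (RingHom.ker (Bialgebra.counitAlgHom k A) : Set A)) =
        RingHom.ker (Bialgebra.counitAlgHom k A)) :
    ∀ n : ℕ, 0 < n → Function.Bijective (convPowId k A n) := by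
  intro n hn
  have : IsCocomm k A := ⟨hcocomm⟩
  have h : (convPowId k A n : A → A) = convPowHom k A n := funext (convPowId_apply k n)
  have htf := htf n hn
  rw [h] at htf ⊢
  exact ⟨convPowHom_injective eq_zero_or_one_of_isIdempotentElem_of_connectedSpace hn,
    (convPowHom k A n).surjective_of_span_image_ker_counit htf⟩
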